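/- Let (W,S) be a Coxeter system with S finite and length function ℓ, and let Q ⊆ J ⊆ S. Let ᴶW^J denote the set of minimal-length (W_J, W_J)-double coset representatives (elements x with ℓ(x) ≤ ℓ(w) for every w ∈ W_J·x·W_J), and set p_{Q,J} = {x ∈ ᴶW^J : J ∩ x⁻¹Jx = Q}, where J ∩ x⁻¹Jx = {s ∈ J : x s x⁻¹ ∈ J} ∩ {s ∈ S : s = x⁻¹tx for some t ∈ J} (i.e., the set of simple reflections s ∈ J with xsx⁻¹ ∈ J, required to equal Q exactly). Then the Poincaré series γ_{p_{Q,J}}(t) = ∑_{n≥0} c_n tⁿ, with c_n = #{x ∈ p_{Q,J} : ℓ(x) = n} (finite since S is finite), is a rational power series: there exist polynomials P, D with rational coefficients, D with nonzero constant term, such that D·γ_{p_{Q,J}} = P as formal power series. -/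

import Mathlib

namespace PQJ

open Classical

section Cox

variable {B : Type*} {W : Type*} [Group W] {M : CoxeterMatrix B} (cs : CoxeterSystem M W)

/-- Action of a simple generator on `W × ZMod 2`. -/
noncomputable def act (s : W) : Function.End (W × ZMod 2) :=
  fun p => (s * p.1 * s, p.2 + if p.1 = s then 1 else 0)

theorem act_pow (s r : W) (hs : s * s = 1) (hr : r * r = 1) (k : ℕ) (t : W) (e : ZMod 2) :
    ((act s * act r) ^ k) (t, e) =
      ((s * r) ^ k * t * ((s * r) ^ k)⁻¹,
        e + ∑ j ∈ Finset.range (2 * k), if t = r * (s * r) ^ j then 1 else 0) := by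
  have hsi : s⁻¹ = s := inv_eq_of_mul_eq_one_left hs
  have hri : r⁻¹ = r := inv_eq_of_mul_eq_one_left hr
  have hpinv : (s * r)⁻¹ = r * s := by rw [mul_inv_rev, hsi, hri]
  have hc : ∀ k : ℕ, ((s * r) ^ k)⁻¹ * r = r * (s * r) ^ k := by
    intro k
    induction k with
    | zero => simp
    | succ k ih =>
      rw [pow_succ, mul_inv_rev, mul_assoc, ih, hpinv, pow_mul_comm']
      simp only [mul_assoc]
  induction k with
  | zero => simp [Function.End.one_def]
  | succ k ih =>
    rw [pow_succ']
    change (act s * act r) (((act s * act r) ^ k) (t, e)) = _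
    rw [ih]
    change act s (act r _) = _
    have e1 : (s * r) ^ k * t * ((s * r) ^ k)⁻¹ = r ↔ t = r * (s * r) ^ (2 * k) := by
      rw [mul_inv_eq_iff_eq_mul, ← eq_inv_mul_iff_mul_eq, ← mul_assoc, hc, mul_assoc, ← pow_add,
        two_mul]
    have e2 : r * ((s * r) ^ k * t * ((s * r) ^ k)⁻¹) * r = s ↔
        t = r * (s * r) ^ (2 * k + 1) := by
      rw [← eq_mul_inv_iff_mul_eq, ← eq_inv_mul_iff_mul_eq, hri, mul_inv_eq_iff_eq_mul,
        ← eq_inv_mul_iff_mul_eq, ← mul_assoc, ← mul_assoc, hc]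
      have : r * (s * r) ^ k * (s * r) * (s * r) ^ k = r * (s * r) ^ (2 * k + 1) := by
        rw [mul_assoc, mul_assoc, ← pow_succ', ← pow_add]; congr 2; ring
      rw [← this]
    simp only [act]
    refine Prod.ext ?_ ?_
    · simp only [pow_succ', mul_assoc, mul_inv_rev, hsi, hri]
    · rw [show 2 * (k + 1) = 2 * k + 1 + 1 by ring, Finset.sum_range_succ, Finset.sum_range_succ]
      simp only [e1, e2, add_assoc]

theorem liftable : M.IsLiftable (fun i => act (cs.simple i)) := by
  intro i j
  funext p
  obtain ⟨t, e⟩ := p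
  rw [act_pow _ _ (cs.simple_mul_simple_self i) (cs.simple_mul_simple_self j)]
  have h1 := cs.simple_mul_simple_pow i j
  rw [h1, two_mul, Finset.sum_range_add]
  simp only [pow_add, h1, one_mul, inv_one, mul_one, Function.End.one_def, id]
  rw [CharTwo.add_self_eq_zero, add_zero]

noncomputable def actHom : W →* Function.End (W × ZMod 2) :=
  cs.lift ⟨_, liftable cs⟩

theorem actHom_simple (i : B) : actHom cs (cs.simple i) = act (cs.simple i) :=
  cs.lift_apply_simple (liftable cs) i

theorem actHom_word (ω : List B) (t : W) (e : ZMod 2) :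
    actHom cs (cs.wordProd ω) (t, e) =
      (cs.wordProd ω * t * (cs.wordProd ω)⁻¹, e + ((cs.rightInvSeq ω).count t : ℕ)) := by
  induction ω with
  | nil => simp [Function.End.one_def]
  | cons i ω ih =>
    rw [cs.wordProd_cons, map_mul]
    change actHom cs (cs.simple i) (actHom cs (cs.wordProd ω) (t, e)) = _
    rw [ih, actHom_simple]
    simp only [act, CoxeterSystem.rightInvSeq, List.count_cons]
    refine Prod.ext ?_ ?_
    · simp [mul_assoc]
    · have : (cs.wordProd ω * t * (cs.wordProd ω)⁻¹ = cs.simple i) ↔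
          ((cs.wordProd ω)⁻¹ * cs.simple i * cs.wordProd ω = t) := by
        rw [mul_inv_eq_iff_eq_mul, ← eq_inv_mul_iff_mul_eq, mul_assoc, eq_comm]
      simp only [this, beq_iff_eq, Nat.cast_add, add_assoc]
      split_ifs <;> simp

noncomputable def nn (w t : W) : ZMod 2 := (actHom cs w (t, 0)).2

theorem actHom_eq (w t : W) (e : ZMod 2) :
    actHom cs w (t, e) = (w * t * w⁻¹, e + nn cs w t) := by
  obtain ⟨ω, rfl⟩ := cs.wordProd_surjective w
  simp [nn, actHom_word]

theorem nn_mul (u v t : W) : nn cs (u * v) t = nn cs v t + nn cs u (v * t * v⁻¹) := by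
  have : actHom cs (u * v) (t, 0) = actHom cs u (actHom cs v (t, 0)) := by
    rw [map_mul]; rfl
  rw [actHom_eq cs v, actHom_eq cs u, actHom_eq] at this
  simpa using congrArg Prod.snd this

theorem nn_one (t : W) : nn cs 1 t = 0 := by
  simp [nn, Function.End.one_def]

theorem nn_refl {t : W} (ht : cs.IsReflection t) : nn cs t t = 1 := by
  obtain ⟨u, i, rfl⟩ := ht
  have h1 : nn cs (cs.simple i) (cs.simple i) = 1 := by
    simp [nn, actHom_simple, act]
  have h2 : nn cs (u⁻¹ * u) (cs.simple i) = 0 := by simp [nn_one]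
  rw [nn_mul] at h2
  rw [nn_mul, nn_mul]
  have e1 : u⁻¹ * (u * cs.simple i * u⁻¹) * u⁻¹⁻¹ = cs.simple i := by group
  rw [e1, h1]
  simp only [cs.simple_mul_simple_self, one_mul, cs.inv_simple]
  rw [add_left_comm, add_comm (nn cs u⁻¹ _), h2, add_zero]

theorem nn_iff {w t : W} (ht : cs.IsReflection t) :
    nn cs w t = 1 ↔ cs.length (w * t) < cs.length w := by
  have key : ∀ w, nn cs w t = 1 → cs.length (w * t) < cs.length w := by
    intro w h
    obtain ⟨ω, hω, rfl⟩ := cs.exists_isReduced w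
    have h2 : ((cs.rightInvSeq ω).count t : ZMod 2) = 1 := by
      simpa [nn, actHom_word] using h
    have : t ∈ cs.rightInvSeq ω := by
      by_contra hn
      rw [List.count_eq_zero_of_not_mem hn] at h2
      simp at h2
    exact (cs.isRightInversion_of_mem_rightInvSeq hω this).2
  refine ⟨key w, fun h => ?_⟩
  by_contra hn
  have h0 : nn cs w t = 0 := by
    generalize nn cs w t = x at hn
    revert x; decide
  have h1 : nn cs (w * t) t = 1 := by
    rw [nn_mul, nn_refl cs ht]
    rw [mul_inv_cancel_right, h0, add_zero]
  have := key _ h1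
  rw [mul_assoc, ht.mul_self, mul_one] at this
  omega

/-- Strong exchange. -/
theorem strong {u v t : W} (ht : cs.IsReflection t) :
    cs.length (u * v * t) < cs.length (u * v) ↔
      ¬ (cs.length (v * t) < cs.length v ↔
        cs.length (u * (v * t * v⁻¹)) < cs.length u) := by
  rw [← nn_iff cs ht, ← nn_iff cs ht, ← nn_iff cs (ht.conj v), nn_mul]
  generalize nn cs v t = x
  generalize nn cs u _ = y
  revert x y; decide

end Cox
end PQJ

namespace PQJ

open Classical

section Comb

variable {B : Type*} {W : Type*} [Group W] {M : CoxeterMatrix B} (cs : CoxeterSystem M W)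

/-- no right descents in `K` -/
def RM (K : Set W) (w : W) : Prop := ∀ s ∈ K, cs.length w < cs.length (w * s)

/-- no left descents in `I` -/
def LM (I : Set W) (w : W) : Prop := ∀ s ∈ I, cs.length w < cs.length (s * w)

theorem LM_inv {I : Set W} (hI : I ⊆ Set.range cs.simple) {w : W} :
    LM cs I w⁻¹ ↔ RM cs I w := by
  refine forall₂_congr fun s hs => ?_
  obtain ⟨i, rfl⟩ := hI hs
  rw [cs.length_inv, ← cs.length_inv (w * _), mul_inv_rev, cs.inv_simple]

theorem RM_inv {I : Set W} (hI : I ⊆ Set.range cs.simple) {w : W} :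
    RM cs I w⁻¹ ↔ LM cs I w := by
  rw [← LM_inv cs hI, inv_inv]

theorem refl_of {s : W} {K : Set W} (hK : K ⊆ Set.range cs.simple) (hs : s ∈ K) :
    cs.IsReflection s := by
  obtain ⟨i, rfl⟩ := hK hs
  exact cs.isReflection_simple i

theorem closure_ind {K : Set W} (hK : K ⊆ Set.range cs.simple) {p : W → Prop} (one : p 1)
    (step : ∀ v ∈ Subgroup.closure K, ∀ s ∈ K, p v → p (v * s)) {v : W}
    (hv : v ∈ Subgroup.closure K) : p v := by
  induction hv using Subgroup.closure_induction_right with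
  | one => exact one
  | mul_right x hx y hy ih => exact step x hx y hy ih
  | mul_inv_cancel x hx y hy ih =>
    rw [(refl_of cs hK hy).inv]; exact step x hx y hy ih

theorem length_mul_min {K : Set W} (hK : K ⊆ Set.range cs.simple) {u : W}
    (hu : ∀ v ∈ Subgroup.closure K, cs.length u ≤ cs.length (u * v)) {v : W}
    (hv : v ∈ Subgroup.closure K) : cs.length (u * v) = cs.length u + cs.length v := by
  refine closure_ind cs hK (p := fun v => cs.length (u * v) = cs.length u + cs.length v) ?_ ?_ hv
  · simp
  · intro v hv s hs ih
    have hsv : s ∈ Subgroup.closure K := Subgroup.subset_closure hs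
    have ht := refl_of cs hK hs
    have h1 := strong cs (u := u) (v := v) ht
    have h2 := hu _ (mul_mem (mul_mem hv hsv) (inv_mem hv))
    obtain ⟨i, rfl⟩ := hK hs
    rw [← mul_assoc]
    have h3 := cs.length_mul_simple v i
    have h4 := cs.length_mul_simple (u * v) i
    by_cases h : cs.length (v * cs.simple i) < cs.length v
    · have := h1.2 (by rw [iff_true_left h]; omega)
      omega
    · have : ¬ cs.length (u * v * cs.simple i) < cs.length (u * v) := by
        rw [h1, not_not, iff_false_left h]; omega
      omega

theorem exists_decomp (K : Set W) (w : W) :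
    ∃ u v, v ∈ Subgroup.closure K ∧ w = u * v ∧
      (∀ v ∈ Subgroup.closure K, cs.length u ≤ cs.length (u * v)) := by
  have hne : {n | ∃ v ∈ Subgroup.closure K, cs.length (w * v) = n}.Nonempty := ⟨_, 1, one_mem _, rfl⟩
  obtain ⟨v, hv, h⟩ := Nat.sInf_mem hne
  refine ⟨w * v, v⁻¹, inv_mem hv, by simp, fun v' hv' => ?_⟩
  rw [h]
  exact Nat.sInf_le ⟨v * v', mul_mem hv hv', by rw [mul_assoc]⟩

theorem exists_word {K : Set W} (hK : K ⊆ Set.range cs.simple) {v : W}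
    (hv : v ∈ Subgroup.closure K) :
    ∃ ω : List B, (∀ i ∈ ω, cs.simple i ∈ K) ∧ cs.wordProd ω = v ∧ ω.length = cs.length v := by
  refine closure_ind cs hK (p := fun v => ∃ ω : List B, (∀ i ∈ ω, cs.simple i ∈ K) ∧
    cs.wordProd ω = v ∧ ω.length = cs.length v) ⟨[], by simp⟩ ?_ hv
  rintro v hv s hs ⟨ω, hω, rfl, hlen⟩
  obtain ⟨i, rfl⟩ := hK hs
  have h3 := cs.length_mul_simple (cs.wordProd ω) i
  by_cases h : cs.length (cs.wordProd ω * cs.simple i) < cs.length (cs.wordProd ω)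
  · have h2 : ((cs.rightInvSeq ω).count (cs.simple i) : ZMod 2) = 1 := by
      have := (nn_iff cs (cs.isReflection_simple i)).2 h
      simpa [nn, actHom_word] using this
    have hm : cs.simple i ∈ cs.rightInvSeq ω := by
      by_contra hn
      rw [List.count_eq_zero_of_not_mem hn] at h2
      simp at h2
    obtain ⟨j, hj, hji⟩ := List.mem_iff_getElem.mp hm
    refine ⟨ω.eraseIdx j, fun k hk => hω k (List.mem_of_mem_eraseIdx hk), ?_, ?_⟩
    · rw [← cs.wordProd_mul_getD_rightInvSeq, List.getD_eq_getElem _ 1 hj, hji]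
    · rw [cs.length_rightInvSeq] at hj
      have := List.length_eraseIdx_add_one hj
      omega
  · refine ⟨ω.concat i, ?_, cs.wordProd_concat i ω, ?_⟩
    · intro k hk
      rw [List.concat_eq_append, List.mem_append] at hk
      rcases hk with hk | hk
      · exact hω k hk
      · rw [List.mem_singleton.1 hk]; exact hs
    · rw [List.length_concat]; omega

theorem eq_one_of_RM {K : Set W} (hK : K ⊆ Set.range cs.simple) {v : W}
    (hv : v ∈ Subgroup.closure K) (h : RM cs K v) : v = 1 := by
  obtain ⟨ω, hω, rfl, hlen⟩ := exists_word cs hK hv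
  rcases List.eq_nil_or_concat ω with rfl | ⟨ω', i, rfl⟩
  · simp
  · exfalso
    have h1 := h (cs.simple i) (hω i (by simp))
    rw [← hlen, List.concat_eq_append, cs.wordProd_append, cs.wordProd_singleton, mul_assoc,
      cs.simple_mul_simple_self, mul_one] at h1
    have := cs.length_wordProd_le ω'
    simp at h1
    omega

/-- B1 -/
theorem length_mul_RM {K : Set W} (hK : K ⊆ Set.range cs.simple) {u : W}
    (hu : RM cs K u) {v : W}
    (hv : v ∈ Subgroup.closure K) : cs.length (u * v) = cs.length u + cs.length v := by
  obtain ⟨u0, v0, hv0, rfl, hmin⟩ := exists_decomp cs K u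
  have : v0 = 1 := by
    apply eq_one_of_RM cs hK hv0
    intro s hs
    have h1 := hu s hs
    rw [mul_assoc, length_mul_min cs hK hmin hv0,
      length_mul_min cs hK hmin (mul_mem hv0 (Subgroup.subset_closure hs))] at h1
    omega
  subst this
  rw [mul_one]
  exact length_mul_min cs hK hmin hv

theorem length_LM_mul {K : Set W} (hK : K ⊆ Set.range cs.simple) {u : W}
    (hu : LM cs K u) {v : W}
    (hv : v ∈ Subgroup.closure K) : cs.length (v * u) = cs.length v + cs.length u := by
  have := length_mul_RM cs hK ((RM_inv cs hK).2 hu) (inv_mem hv)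
  rw [← mul_inv_rev, cs.length_inv, cs.length_inv, cs.length_inv] at this
  omega

/-- B2 -/
theorem exists_RM_decomp {K : Set W} (hK : K ⊆ Set.range cs.simple) (w : W) :
    ∃ u v, RM cs K u ∧ v ∈ Subgroup.closure K ∧ w = u * v := by
  obtain ⟨u, v, hv, hw, hmin⟩ := exists_decomp cs K w
  refine ⟨u, v, fun s hs => ?_, hv, hw⟩
  have := hmin s (Subgroup.subset_closure hs)
  exact lt_of_le_of_ne this ((refl_of cs hK hs).length_mul_left_ne u).symm

theorem exists_LM_decomp {K : Set W} (hK : K ⊆ Set.range cs.simple) (w : W) :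
    ∃ u v, LM cs K u ∧ v ∈ Subgroup.closure K ∧ w = v * u := by
  obtain ⟨u, v, hu, hv, hw⟩ := exists_RM_decomp cs hK w⁻¹
  refine ⟨u⁻¹, v⁻¹, (LM_inv cs hK).2 hu, inv_mem hv, ?_⟩
  rw [← mul_inv_rev, ← hw, inv_inv]

theorem decomp_unique {K : Set W} (hK : K ⊆ Set.range cs.simple) {u v u' v' : W}
    (hu : RM cs K u) (hu' : RM cs K u') (hv : v ∈ Subgroup.closure K)
    (hv' : v' ∈ Subgroup.closure K) (h : u * v = u' * v') : u = u' ∧ v = v' := by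
  have h1 : u = u' * (v' * v⁻¹) := by rw [← mul_assoc, ← h]; group
  have h2 : u' = u * (v * v'⁻¹) := by rw [← mul_assoc, h]; group
  have e1 := length_mul_RM cs hK hu' (mul_mem hv' (inv_mem hv))
  have e2 := length_mul_RM cs hK hu (mul_mem hv (inv_mem hv'))
  rw [← h1] at e1
  rw [← h2] at e2
  have : v * v'⁻¹ = 1 := cs.length_eq_zero_iff.1 (by omega)
  rw [this, mul_one] at h2
  exact ⟨h2.symm, mul_inv_eq_one.1 this⟩

theorem mem_of_length_one {K : Set W} (hK : K ⊆ Set.range cs.simple) {v : W}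
    (hv : v ∈ Subgroup.closure K) (h : cs.length v = 1) : v ∈ K := by
  obtain ⟨ω, hω, rfl, hlen⟩ := exists_word cs hK hv
  rw [h, List.length_eq_one_iff] at hlen
  obtain ⟨i, rfl⟩ := hlen
  simpa using hω i (by simp)

/-- B3 -/
theorem LM_mul_iff {K I : Set W} (hK : K ⊆ Set.range cs.simple) (hI : I ⊆ Set.range cs.simple)
    {u v : W} (hu : RM cs K u) (hu' : LM cs I u) (hv : v ∈ Subgroup.closure K) :
    LM cs I (u * v) ↔ LM cs {s | s ∈ K ∧ u * s * u⁻¹ ∈ I} v := by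
  constructor
  · rintro h r ⟨hrK, hrI⟩
    have h1 := h _ hrI
    have e : u * r * u⁻¹ * (u * v) = u * (r * v) := by group
    rw [e, length_mul_RM cs hK hu (mul_mem (Subgroup.subset_closure hrK) hv),
      length_mul_RM cs hK hu hv] at h1
    omega
  · intro h i hi
    by_cases hiu : RM cs K (i * u)
    · rw [← mul_assoc, length_mul_RM cs hK hiu hv, length_mul_RM cs hK hu hv]
      have := hu' i hi
      omega
    · unfold RM at hiu
      push Not at hiu
      obtain ⟨k, hk, hle⟩ := hiu
      have hlt := lt_of_le_of_ne hle ((refl_of cs hK hk).length_mul_left_ne _)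
      rw [strong cs (refl_of cs hK hk)] at hlt
      have h1 := hu k hk
      have h2 : cs.length (i * (u * k * u⁻¹)) < cs.length i := by
        by_contra hcon
        apply hlt
        constructor <;> intro <;> omega
      obtain ⟨j, rfl⟩ := hI hi
      rw [cs.length_simple, Nat.lt_one_iff, cs.length_eq_zero_iff, mul_eq_one_iff_inv_eq,
        cs.inv_simple] at h2
      have h3 := h k ⟨hk, h2 ▸ hi⟩
      have e : cs.simple j * (u * v) = u * (k * v) := by rw [h2]; group
      rw [e, length_mul_RM cs hK hu hv,
        length_mul_RM cs hK hu (mul_mem (Subgroup.subset_closure hk) hv)]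
      omega

/-- B4 -/
theorem conj_mem_iff {K I : Set W} (hK : K ⊆ Set.range cs.simple) (hI : I ⊆ Set.range cs.simple)
    {u v s : W} (hu : RM cs K u) (hu' : LM cs I u) (hv : v ∈ Subgroup.closure K) (hs : s ∈ K) :
    (u * v) * s * (u * v)⁻¹ ∈ I ↔ v * s * v⁻¹ ∈ {s | s ∈ K ∧ u * s * u⁻¹ ∈ I} := by
  have e : (u * v) * s * (u * v)⁻¹ = u * (v * s * v⁻¹) * u⁻¹ := by group
  have ht : v * s * v⁻¹ ∈ Subgroup.closure K :=
    mul_mem (mul_mem hv (Subgroup.subset_closure hs)) (inv_mem hv)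
  rw [e]
  refine ⟨fun h => ⟨?_, h⟩, fun h => h.2⟩
  apply mem_of_length_one cs hK ht
  have h1 := hu' _ h
  have e2 : u * (v * s * v⁻¹) * u⁻¹ * u = u * (v * s * v⁻¹) := by group
  obtain ⟨i, hi⟩ := hI h
  have h2 := cs.length_mul_le (cs.simple i) u
  rw [cs.length_simple, hi, e2] at h2
  rw [e2] at h1
  rw [length_mul_RM cs hK hu ht] at h1 h2
  omega

theorem RM_mul_iff {K Q : Set W} (hK : K ⊆ Set.range cs.simple) (hQ : Q ⊆ K)
    {u v : W} (hu : RM cs K u) (hv : v ∈ Subgroup.closure K) :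
    RM cs Q (u * v) ↔ RM cs Q v := by
  refine forall₂_congr fun s hs => ?_
  rw [mul_assoc, length_mul_RM cs hK hu hv,
    length_mul_RM cs hK hu (mul_mem hv (Subgroup.subset_closure (hQ hs)))]
  omega

theorem LM_of_mul {K I : Set W} (hK : K ⊆ Set.range cs.simple)
    {u v : W} (hu : RM cs K u) (hv : v ∈ Subgroup.closure K)
    (h : LM cs I (u * v)) : LM cs I u := by
  intro i hi
  have h1 := h i hi
  have h2 := cs.length_mul_le (i * u) v
  rw [length_mul_RM cs hK hu hv] at h1
  rw [mul_assoc] at h2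
  omega

/-- double coset minimality -/
theorem double_min {J : Set W} (hJ : J ⊆ Set.range cs.simple) {x : W} :
    (∀ a ∈ Subgroup.closure J, ∀ b ∈ Subgroup.closure J, cs.length x ≤ cs.length (a * x * b)) ↔
      LM cs J x ∧ RM cs J x := by
  constructor
  · intro h
    constructor
    · intro s hs
      have := h s (Subgroup.subset_closure hs) 1 (one_mem _)
      rw [mul_one] at this
      exact lt_of_le_of_ne this ((refl_of cs hJ hs).length_mul_right_ne x).symm
    · intro s hs
      have := h 1 (one_mem _) s (Subgroup.subset_closure hs)
      rw [one_mul] at this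
      exact lt_of_le_of_ne this ((refl_of cs hJ hs).length_mul_left_ne x).symm
  · rintro ⟨hL, hR⟩ a ha b hb
    have hRJ : {s | s ∈ J ∧ x * s * x⁻¹ ∈ J} ⊆ J := fun s hs => hs.1
    obtain ⟨b', r, hb', hr, rfl⟩ := exists_LM_decomp cs (hRJ.trans hJ) b
    have hrJ : r ∈ Subgroup.closure J := Subgroup.closure_mono hRJ hr
    have hb'J : b' ∈ Subgroup.closure J := by
      have := mul_mem (inv_mem hrJ) hb
      simpa using this
    have hc : x * r * x⁻¹ ∈ Subgroup.closure J := by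
      refine closure_ind cs (hRJ.trans hJ) (p := fun r => x * r * x⁻¹ ∈ Subgroup.closure J)
        (by simp) ?_ hr
      intro v _ s hs ih
      have e : x * (v * s) * x⁻¹ = (x * v * x⁻¹) * (x * s * x⁻¹) := by group
      rw [e]
      exact mul_mem ih (Subgroup.subset_closure hs.2)
    have hLM := (LM_mul_iff cs hJ hJ hR hL hb'J).2 hb'
    have e : a * x * (r * b') = (a * (x * r * x⁻¹)) * (x * b') := by group
    rw [e, length_LM_mul cs hJ hLM (mul_mem ha hc), length_mul_RM cs hJ hR hb'J]
    omega

/-- Bruhat order -/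
def BR : W → W → Prop :=
  Relation.ReflTransGen (fun x z => ∃ t, cs.IsReflection t ∧ z = x * t ∧ cs.length x < cs.length z)

theorem BR_length {x z : W} (h : BR cs x z) : cs.length x ≤ cs.length z := by
  induction h with
  | refl => exact le_rfl
  | tail _ h ih => obtain ⟨t, _, _, h⟩ := h; omega

theorem BR_simple {z s : W} (hs : cs.IsReflection s) (h : cs.length (z * s) < cs.length z) :
    BR cs (z * s) z :=
  Relation.ReflTransGen.single ⟨s, hs, by rw [mul_assoc, hs.mul_self, mul_one], h⟩

theorem BR_step {x t s : W} (ht : cs.IsReflection t) (hs : s ∈ Set.range cs.simple) (hne : t ≠ s)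
    (h : cs.length x < cs.length (x * t)) : BR cs (x * s) (x * t * s) := by
  obtain ⟨i, rfl⟩ := hs
  have ht' := ht.conj (cs.simple i)
  refine Relation.ReflTransGen.single ⟨_, ht', ?_, ?_⟩
  · simp [mul_assoc]
  · have h1 := strong cs (u := x) (v := cs.simple i) ht'
    rw [cs.length_simple] at h1
    have e : cs.simple i * (cs.simple i * t * (cs.simple i)⁻¹) = t * cs.simple i := by
      simp [mul_assoc]
    have e2 : t * cs.simple i * (cs.simple i)⁻¹ = t := by group
    have e3 : x * cs.simple i * (cs.simple i * t * (cs.simple i)⁻¹) = x * t * cs.simple i := by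
      simp [mul_assoc]
    rw [e, e2, e3] at h1
    have h2 : ¬ cs.length (t * cs.simple i) < 1 := by
      rw [Nat.lt_one_iff, cs.length_eq_zero_iff, mul_eq_one_iff_eq_inv, cs.inv_simple]
      exact hne
    have h3 : ¬ cs.length (x * t * cs.simple i) < cs.length (x * cs.simple i) := by
      rw [h1, not_not]
      constructor <;> intro <;> omega
    have h4 := ht'.length_mul_left_ne (x * cs.simple i)
    rw [e3] at h4
    omega

theorem BR_mul {x z s : W} (hs : s ∈ Set.range cs.simple) (h : BR cs x z) :
    BR cs (x * s) z ∨ BR cs (x * s) (z * s) := by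
  induction h with
  | refl => exact Or.inr Relation.ReflTransGen.refl
  | @tail y z hxy hyz ih =>
    have hyz' : BR cs y z := Relation.ReflTransGen.single hyz
    obtain ⟨t, ht, rfl, hlt⟩ := hyz
    rcases ih with ih | ih
    · exact Or.inl (ih.trans hyz')
    · by_cases hts : t = s
      · subst hts; exact Or.inl ih
      · exact Or.inr (ih.trans (BR_step cs ht hs hts hlt))

theorem BR_mul' {x z s : W} (hs : s ∈ Set.range cs.simple) (h : BR cs x z) :
    BR cs x (z * s) ∨ BR cs (x * s) (z * s) := by
  induction h with
  | refl => exact Or.inr Relation.ReflTransGen.refl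
  | @tail y z hxy hyz ih =>
    obtain ⟨t, ht, rfl, hlt⟩ := hyz
    by_cases hts : t = s
    · subst hts
      left
      rw [mul_assoc, ht.mul_self, mul_one]
      exact hxy
    · have := BR_step cs ht hs hts hlt
      exact ih.imp (fun h => h.trans this) (fun h => h.trans this)

theorem BR_one (z : W) : BR cs 1 z := by
  generalize hn : cs.length z = n
  induction n using Nat.strong_induction_on generalizing z with
  | _ n ih =>
    by_cases hz : z = 1
    · subst hz; exact Relation.ReflTransGen.refl
    · obtain ⟨i, hi⟩ := cs.exists_rightDescent_of_ne_one hz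
      have hi' : cs.length (z * cs.simple i) < cs.length z := hi
      exact (ih _ (hn ▸ hi') _ rfl).trans (BR_simple cs (cs.isReflection_simple i) hi')

/-- Elements with the extremal descent condition bound the length of minimal representatives. -/
theorem extremal_bound {T I Q : Set W} (hT : T ⊆ Set.range cs.simple)
    (hI : I ⊆ Set.range cs.simple) (hQT : Q ⊆ T) {w : W} (hL : LM cs I w)
    (hQ : ∀ s ∈ Q, w * s * w⁻¹ ∈ I)
    (hD : ∀ s ∈ T, s ∉ Q → cs.length (w * s) < cs.length w) {y : W}
    (hy : y ∈ Subgroup.closure T) (hyQ : RM cs Q y) : cs.length y ≤ cs.length w := by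
  have hQS := hQT.trans hT
  have hconj : ∀ a ∈ Subgroup.closure Q, w * a * w⁻¹ ∈ Subgroup.closure I := by
    intro a ha
    refine closure_ind cs hQS (p := fun r => w * r * w⁻¹ ∈ Subgroup.closure I)
      (by simp) ?_ ha
    intro v _ s hs ih
    have e : w * (v * s) * w⁻¹ = (w * v * w⁻¹) * (w * s * w⁻¹) := by group
    rw [e]
    exact mul_mem ih (Subgroup.subset_closure (hQ s hs))
  have hD' : ∀ a ∈ Subgroup.closure Q, ∀ s ∈ T, s ∉ Q →
      cs.length (w * a * s) < cs.length (w * a) := by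
    intro a ha s hs hsQ
    have e1 : w * a * s = (w * a * w⁻¹) * (w * s) := by group
    have e2 : w * a = (w * a * w⁻¹) * w := by group
    have h1 := cs.length_mul_le (w * a * w⁻¹) (w * s)
    have h2 := length_LM_mul cs hI hL (hconj a ha)
    rw [← e1] at h1
    rw [← e2] at h2
    have := hD s hs hsQ
    omega
  have h1 : ∃ a ∈ Subgroup.closure Q, BR cs y (w * a) := by
    refine closure_ind cs hT (p := fun y => ∃ a ∈ Subgroup.closure Q, BR cs y (w * a))
      ⟨1, one_mem _, BR_one cs _⟩ ?_ hy
    rintro v _ s hs ⟨a, ha, h⟩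
    rcases BR_mul cs (hT hs) h with h' | h'
    · exact ⟨a, ha, h'⟩
    · by_cases hsQ : s ∈ Q
      · exact ⟨a * s, mul_mem ha (Subgroup.subset_closure hsQ), by rwa [← mul_assoc]⟩
      · exact ⟨a, ha, h'.trans (BR_simple cs (refl_of cs hT hs) (hD' a ha s hs hsQ))⟩
  obtain ⟨a, ha, hya⟩ := h1
  have h2 : ∀ x, BR cs x (w * a) → ∃ b ∈ Subgroup.closure Q, BR cs (x * b) w := by
    refine closure_ind cs hQS
      (p := fun a => ∀ x, BR cs x (w * a) → ∃ b ∈ Subgroup.closure Q, BR cs (x * b) w) ?_ ?_ ha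
    · intro x hx
      exact ⟨1, one_mem _, by simpa using hx⟩
    · intro v _ s hs ih x hx
      have hss := (refl_of cs hQS hs).mul_self
      have := BR_mul' cs (hQS hs) hx
      rw [← mul_assoc, mul_assoc (w * v), hss, mul_one] at this
      rcases this with h | h
      · exact ih x h
      · obtain ⟨b, hb, hbw⟩ := ih _ h
        exact ⟨s * b, mul_mem (Subgroup.subset_closure hs) hb, by rwa [← mul_assoc]⟩
  obtain ⟨b, hb, hbw⟩ := h2 y hya
  have := BR_length cs hbw
  rw [length_mul_RM cs hQS hyQ hb] at this
  omega

end Comb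
end PQJ

namespace PQJ

open Classical

section Rational

/-- Rational power series (with denominators invertible at `0`). -/
noncomputable def Rat : Subring (PowerSeries ℚ) where
  carrier := {f | ∃ P D : Polynomial ℚ, D.coeff 0 ≠ 0 ∧ (D : PowerSeries ℚ) * f = P}
  mul_mem' := by
    rintro f g ⟨P, D, hD, h⟩ ⟨P', D', hD', h'⟩
    refine ⟨P * P', D * D', by rw [Polynomial.mul_coeff_zero]; exact mul_ne_zero hD hD', ?_⟩
    rw [Polynomial.coe_mul, Polynomial.coe_mul, ← h, ← h']; ring
  one_mem' := ⟨1, 1, by simp, by simp⟩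
  add_mem' := by
    rintro f g ⟨P, D, hD, h⟩ ⟨P', D', hD', h'⟩
    refine ⟨P * D' + P' * D, D * D', by rw [Polynomial.mul_coeff_zero]; exact mul_ne_zero hD hD', ?_⟩
    rw [Polynomial.coe_mul, Polynomial.coe_add, Polynomial.coe_mul, Polynomial.coe_mul, ← h, ← h']
    ring
  zero_mem' := ⟨0, 1, by simp, by simp⟩
  neg_mem' := by
    rintro f ⟨P, D, hD, h⟩
    exact ⟨-P, D, hD, by rw [Polynomial.coe_neg, ← h]; ring⟩

theorem Rat_inv {f g : PowerSeries ℚ} (hf : f ∈ Rat) (h0 : PowerSeries.constantCoeff f ≠ 0)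
    (hfg : f * g = 1) : g ∈ Rat := by
  obtain ⟨P, D, hD, h⟩ := hf
  refine ⟨D, P, ?_, ?_⟩
  · have := congrArg PowerSeries.constantCoeff h
    rw [map_mul, Polynomial.constantCoeff_coe, Polynomial.constantCoeff_coe] at this
    rw [← this]
    exact mul_ne_zero hD h0
  · rw [← h, mul_assoc, hfg, mul_one]

noncomputable def mm : Ideal Rat :=
  RingHom.ker ((PowerSeries.constantCoeff (R := ℚ)).comp Rat.subtype)

theorem mm_le : mm ≤ Ideal.jacobson ⊥ := by
  intro x hx
  rw [Ideal.mem_jacobson_bot]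
  intro y
  have hx' : PowerSeries.constantCoeff (x : PowerSeries ℚ) = 0 := hx
  have h0 : PowerSeries.constantCoeff ((x * y + 1 : Rat) : PowerSeries ℚ) = 1 := by
    simp [hx']
  have h1 : ((x * y + 1 : Rat) : PowerSeries ℚ) * ((x * y + 1 : Rat) : PowerSeries ℚ)⁻¹ = 1 :=
    PowerSeries.mul_inv_cancel _ (by rw [h0]; exact one_ne_zero)
  have h2 := Rat_inv (x * y + 1 : Rat).2 (by rw [h0]; exact one_ne_zero) h1
  exact IsUnit.of_mul_eq_one ⟨_, h2⟩ (Subtype.ext h1)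

theorem mem_span_one {f : PowerSeries ℚ} :
    f ∈ Submodule.span Rat {(1 : PowerSeries ℚ)} ↔ f ∈ Rat := by
  rw [Submodule.mem_span_singleton]
  constructor
  · rintro ⟨a, rfl⟩
    change (a : PowerSeries ℚ) * 1 ∈ Rat
    rw [mul_one]; exact a.2
  · intro h
    exact ⟨⟨f, h⟩, mul_one f⟩

/-- Nakayama for rational power series. -/
theorem nakayama {G : Set (PowerSeries ℚ)} (hG : G.Finite)
    (h : ∀ g ∈ G, g ∈ Submodule.span Rat {(1 : PowerSeries ℚ)} ⊔ mm • Submodule.span Rat G) :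
    ∀ g ∈ G, g ∈ Rat := by
  intro g hg
  rw [← mem_span_one]
  have : Submodule.span Rat G ≤ Submodule.span Rat {(1 : PowerSeries ℚ)} := by
    apply Submodule.le_of_le_smul_of_le_jacobson_bot (I := mm) (Submodule.fg_span hG) mm_le
    exact Submodule.span_le.2 h
  exact this (Submodule.subset_span hg)

end Rational

section Gam

variable {B : Type*} [Fintype B] {W : Type*} [Group W] {M : CoxeterMatrix B}
  (cs : CoxeterSystem M W)

theorem level_finite (n : ℕ) : {w : W | cs.length w = n}.Finite := by
  refine ((List.finite_length_eq B n).image cs.wordProd).subset ?_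
  intro w hw
  obtain ⟨ω, hω, rfl⟩ := cs.exists_isReduced w
  exact ⟨ω, hω.symm.trans hw, rfl⟩

noncomputable def level (n : ℕ) : Finset W := (level_finite cs n).toFinset

theorem mem_level {n : ℕ} {w : W} : w ∈ level cs n ↔ cs.length w = n := by simp [level]

noncomputable def cut (X : Set W) (n : ℕ) : Finset W := (level cs n).filter (· ∈ X)

theorem mem_cut {X : Set W} {n : ℕ} {w : W} : w ∈ cut cs X n ↔ w ∈ X ∧ cs.length w = n := by
  simp [cut, mem_level, and_comm]

noncomputable def gam (X : Set W) : PowerSeries ℚ := PowerSeries.mk fun n => ((cut cs X n).card : ℚ)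

theorem gam_eq_ncard (X : Set W) :
    gam cs X = PowerSeries.mk fun n => (({x | x ∈ X ∧ cs.length x = n} : Set W).ncard : ℚ) := by
  unfold gam
  congr 1
  funext n
  rw [← Set.ncard_coe_finset]
  congr 2
  ext w
  simp [mem_cut]

theorem gam_const (X : Set W) :
    PowerSeries.constantCoeff (gam cs X) = if 1 ∈ X then 1 else 0 := by
  rw [← PowerSeries.coeff_zero_eq_constantCoeff_apply, gam, PowerSeries.coeff_mk]
  split_ifs with h
  · have : cut cs X 0 = {1} := by
      ext w; rw [mem_cut, cs.length_eq_zero_iff, Finset.mem_singleton]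
      exact ⟨fun h => h.2, fun hw => ⟨hw ▸ h, hw⟩⟩
    rw [this]; simp
  · have : cut cs X 0 = ∅ := by
      ext w; rw [mem_cut, cs.length_eq_zero_iff]
      simp only [Finset.notMem_empty, iff_false]
      rintro ⟨h1, rfl⟩; exact h h1
    rw [this]; simp

theorem gam_bounded {X : Set W} {m : ℕ} (h : ∀ w ∈ X, cs.length w ≤ m) : gam cs X ∈ Rat := by
  refine ⟨PowerSeries.trunc (m + 1) (gam cs X), 1, by simp, ?_⟩
  rw [Polynomial.coe_one, one_mul]
  ext n
  rw [Polynomial.coeff_coe, PowerSeries.coeff_trunc]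
  split_ifs with hn
  · rfl
  · rw [gam, PowerSeries.coeff_mk]
    have : cut cs X n = ∅ := by
      ext w; rw [mem_cut]
      simp only [Finset.notMem_empty, iff_false]
      rintro ⟨h1, h2⟩
      have := h w h1
      omega
    rw [this]; simp

theorem gam_one : gam cs {(1 : W)} = 1 := by
  ext n
  rw [gam, PowerSeries.coeff_mk, PowerSeries.coeff_one]
  split_ifs with h
  · have : cut cs {(1 : W)} n = {1} := by
      ext w; rw [mem_cut, h, cs.length_eq_zero_iff]; simp
    rw [this]; simp
  · have : cut cs {(1 : W)} n = ∅ := by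
      ext w; rw [mem_cut]
      simp only [Finset.notMem_empty, iff_false]
      rintro ⟨rfl, h2⟩
      rw [cs.length_one] at h2
      exact h h2.symm
    rw [this]; simp

theorem gam_sum_prod {ι : Type*} (Z : Set W) (s : Finset ι) (Xf Yf : ι → Set W)
    (hmem : ∀ R ∈ s, ∀ u ∈ Xf R, ∀ v ∈ Yf R, u * v ∈ Z ∧
      cs.length (u * v) = cs.length u + cs.length v)
    (hsurj : ∀ w ∈ Z, ∃ R ∈ s, ∃ u ∈ Xf R, ∃ v ∈ Yf R, w = u * v)
    (hinj : ∀ R ∈ s, ∀ R' ∈ s, ∀ u ∈ Xf R, ∀ v ∈ Yf R, ∀ u' ∈ Xf R', ∀ v' ∈ Yf R',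
      u * v = u' * v' → R = R' ∧ u = u' ∧ v = v') :
    gam cs Z = ∑ R ∈ s, gam cs (Xf R) * gam cs (Yf R) := by
  ext n
  rw [map_sum]
  simp only [PowerSeries.coeff_mul]
  simp only [gam, PowerSeries.coeff_mk]
  rw [← Finset.sum_product']
  norm_cast
  have e : ∑ x ∈ s ×ˢ Finset.HasAntidiagonal.antidiagonal n,
      (cut cs (Xf x.1) x.2.1).card * (cut cs (Yf x.1) x.2.2).card =
      ((s ×ˢ Finset.HasAntidiagonal.antidiagonal n).sigma
        (fun x => cut cs (Xf x.1) x.2.1 ×ˢ cut cs (Yf x.1) x.2.2)).card := by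
    rw [Finset.card_sigma]
    simp only [Finset.card_product]
  rw [e]
  symm
  refine Finset.card_bij (fun x _ => x.2.1 * x.2.2) ?_ ?_ ?_
  · rintro ⟨⟨R, p, q⟩, u, v⟩ h
    simp only [Finset.mem_sigma, Finset.mem_product, Finset.HasAntidiagonal.mem_antidiagonal, mem_cut] at h
    obtain ⟨⟨hR, hpq⟩, ⟨hu, hul⟩, hv, hvl⟩ := h
    have := hmem R hR u hu v hv
    rw [mem_cut]
    exact ⟨this.1, by simp only; omega⟩
  · rintro ⟨⟨R, p, q⟩, u, v⟩ h ⟨⟨R', p', q'⟩, u', v'⟩ h' heq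
    simp only [Finset.mem_sigma, Finset.mem_product, Finset.HasAntidiagonal.mem_antidiagonal, mem_cut] at h h'
    obtain ⟨⟨hR, hpq⟩, ⟨hu, hul⟩, hv, hvl⟩ := h
    obtain ⟨⟨hR', hpq'⟩, ⟨hu', hul'⟩, hv', hvl'⟩ := h'
    obtain ⟨rfl, rfl, rfl⟩ := hinj R hR R' hR' u hu v hv u' hu' v' hv' heq
    subst hul hvl hul' hvl'
    rfl
  · intro w hw
    rw [mem_cut] at hw
    obtain ⟨R, hR, u, hu, v, hv, rfl⟩ := hsurj w hw.1
    have := hmem R hR u hu v hv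
    refine ⟨⟨(R, cs.length u, cs.length v), u, v⟩, ?_, rfl⟩
    simp only [Finset.mem_sigma, Finset.mem_product, Finset.HasAntidiagonal.mem_antidiagonal, mem_cut]
    exact ⟨⟨hR, by omega⟩, ⟨hu, trivial⟩, hv, trivial⟩

theorem gam_sum_disj {ι : Type*} (Z : Set W) (s : Finset ι) (Xf : ι → Set W)
    (hmem : ∀ R ∈ s, ∀ u ∈ Xf R, u ∈ Z) (hsurj : ∀ w ∈ Z, ∃ R ∈ s, w ∈ Xf R)
    (hinj : ∀ R ∈ s, ∀ R' ∈ s, ∀ u ∈ Xf R, u ∈ Xf R' → R = R') :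
    gam cs Z = ∑ R ∈ s, gam cs (Xf R) := by
  rw [gam_sum_prod cs Z s Xf (fun _ => {1})]
  · simp [gam_one]
  · rintro R hR u hu v rfl
    simpa using hmem R hR u hu
  · intro w hw
    obtain ⟨R, hR, h⟩ := hsurj w hw
    exact ⟨R, hR, w, h, 1, rfl, by simp⟩
  · rintro R hR R' hR' u hu v rfl u' hu' v' rfl h
    simp only [mul_one] at h
    subst h
    exact ⟨hinj R hR R' hR' u hu hu', rfl, rfl⟩

theorem coeff_gam (X : Set W) (n : ℕ) :
    PowerSeries.coeff n (gam cs X) = ∑ w ∈ level cs n, if w ∈ X then (1 : ℚ) else 0 := by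
  rw [gam, PowerSeries.coeff_mk, cut, Finset.card_filter]
  push_cast
  rfl

def XX (T I K R : Finset W) : Set W :=
  {w | w ∈ Subgroup.closure (T : Set W) ∧ LM cs I w ∧ RM cs K w ∧
    K.filter (fun s => w * s * w⁻¹ ∈ I) = R}

variable {T I K Q : Finset W}

theorem RM_mono {K Q : Set W} (h : Q ⊆ K) {w : W} (hw : RM cs K w) : RM cs Q w :=
  fun s hs => hw s (h hs)

theorem eqA (hT : (T : Set W) ⊆ Set.range cs.simple)
    (hI : (I : Set W) ⊆ Set.range cs.simple) (hQK : Q ⊆ K) (hKT : K ⊆ T) :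
    gam cs (XX cs T I Q Q) =
      ∑ R ∈ K.powerset, gam cs (XX cs T I K R) * gam cs (XX cs K R Q Q) := by
  have hK : (K : Set W) ⊆ Set.range cs.simple := (Finset.coe_subset.2 hKT).trans hT
  have hcl : Subgroup.closure (K : Set W) ≤ Subgroup.closure (T : Set W) :=
    Subgroup.closure_mono (Finset.coe_subset.2 hKT)
  have hset : ∀ u : W, ((K.filter (fun s => u * s * u⁻¹ ∈ I) : Finset W) : Set W) =
      {s | s ∈ (K : Set W) ∧ u * s * u⁻¹ ∈ (I : Set W)} := by
    intro u; ext s; simp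
  apply gam_sum_prod
  · rintro R _ u ⟨huT, huL, huR, hf⟩ v ⟨hvK, hvL, hvR, hvf⟩
    refine ⟨⟨mul_mem huT (hcl hvK), ?_, ?_, ?_⟩, length_mul_RM cs hK huR hvK⟩
    · rw [LM_mul_iff cs hK hI huR huL hvK, ← hset, hf]; exact hvL
    · rw [RM_mul_iff cs hK (Finset.coe_subset.2 hQK) huR hvK]; exact hvR
    · rw [Finset.filter_eq_self] at hvf ⊢
      intro s hs
      have h1 := hvf s hs
      have h2 := (conj_mem_iff cs hK hI huR huL hvK (s := s) (Finset.mem_coe.2 (hQK hs))).2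
      rw [← hset, hf] at h2
      exact h2 h1
  · rintro w ⟨hwT, hwL, hwR, hwf⟩
    obtain ⟨u, v, hu, hv, rfl⟩ := exists_RM_decomp cs hK w
    have huL := LM_of_mul cs hK hu hv hwL
    refine ⟨K.filter (fun s => u * s * u⁻¹ ∈ I), Finset.mem_powerset.2 (Finset.filter_subset _ _),
      u, ⟨?_, huL, hu, rfl⟩, v, ⟨hv, ?_, ?_, ?_⟩, rfl⟩
    · have := mul_mem hwT (inv_mem (hcl hv))
      simpa using this
    · rw [hset, ← LM_mul_iff cs hK hI hu huL hv]; exact hwL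
    · rw [← RM_mul_iff cs hK (Finset.coe_subset.2 hQK) hu hv]; exact hwR
    · rw [Finset.filter_eq_self] at hwf ⊢
      intro s hs
      have h2 := (conj_mem_iff cs hK hI hu huL hv (s := s) (Finset.mem_coe.2 (hQK hs))).1 (hwf s hs)
      rw [← hset] at h2
      exact h2
  · rintro R _ R' _ u ⟨_, _, hu, hf⟩ v ⟨hv, _⟩ u' ⟨_, _, hu', hf'⟩ v' ⟨hv', _⟩ h
    obtain ⟨rfl, rfl⟩ := decomp_unique cs hK hu hu' hv hv' h
    exact ⟨hf.symm.trans hf', rfl, rfl⟩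

theorem eqG (hQK : Q ⊆ K) :
    gam cs {w | w ∈ XX cs T I Q Q ∧ RM cs (K : Set W) w} =
      ∑ R ∈ K.powerset.filter (Q ⊆ ·), gam cs (XX cs T I K R) := by
  apply gam_sum_disj
  · rintro R hR u ⟨huT, huL, huR, hf⟩
    rw [Finset.mem_filter] at hR
    refine ⟨⟨huT, huL, RM_mono cs (Finset.coe_subset.2 hQK) huR, ?_⟩, huR⟩
    rw [Finset.filter_eq_self]
    intro s hs
    have := hR.2 hs
    rw [← hf, Finset.mem_filter] at this
    exact this.2
  · rintro w ⟨⟨hwT, hwL, hwR, hwf⟩, hw⟩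
    refine ⟨K.filter (fun s => w * s * w⁻¹ ∈ I), ?_, hwT, hwL, hw, rfl⟩
    rw [Finset.mem_filter, Finset.mem_powerset]
    refine ⟨Finset.filter_subset _ _, ?_⟩
    rw [Finset.filter_eq_self] at hwf
    intro s hs
    exact Finset.mem_filter.2 ⟨hQK hs, hwf s hs⟩
  · rintro R _ R' _ u ⟨_, _, _, hf⟩ ⟨_, _, _, hf'⟩
    exact hf.symm.trans hf'

theorem eqIE :
    ∑ L ∈ (T \ Q).powerset, (-1 : PowerSeries ℚ) ^ L.card *
        gam cs {w | w ∈ XX cs T I Q Q ∧ RM cs ((Q ∪ L : Finset W) : Set W) w} =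
      gam cs {w | w ∈ XX cs T I Q Q ∧ ∀ s ∈ T \ Q, ¬ cs.length w < cs.length (w * s)} := by
  ext n
  rw [map_sum]
  have h1 : ∀ (k : ℕ) (f : PowerSeries ℚ), PowerSeries.coeff n ((-1 : PowerSeries ℚ) ^ k * f) =
      (-1 : ℚ) ^ k * PowerSeries.coeff n f := by
    intro k f
    rcases neg_one_pow_eq_or (PowerSeries ℚ) k with h | h
    · rcases Nat.even_or_odd k with hk | hk
      · simp [hk.neg_one_pow]
      · simp [hk.neg_one_pow]
    · rcases Nat.even_or_odd k with hk | hk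
      · simp [hk.neg_one_pow]
      · simp [hk.neg_one_pow]
  simp only [h1, coeff_gam, Finset.mul_sum]
  rw [Finset.sum_comm]
  refine Finset.sum_congr rfl fun w _ => ?_
  by_cases hw : w ∈ XX cs T I Q Q
  · simp only [Set.mem_ofPred_eq, hw, true_and, mul_ite, mul_one, mul_zero]
    rw [← Finset.sum_filter]
    have hf : (T \ Q).powerset.filter (fun L => RM cs ((Q ∪ L : Finset W) : Set W) w) =
        ((T \ Q).filter (fun s => cs.length w < cs.length (w * s))).powerset := by
      ext L
      rw [Finset.mem_filter, Finset.mem_powerset, Finset.mem_powerset, Finset.subset_iff (s₂ := Finset.filter _ _)]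
      simp only [Finset.mem_filter, forall_and, ← Finset.subset_iff]
      refine and_congr_right fun _ => ?_
      constructor
      · intro h s hs
        exact h s (by simp [hs])
      · intro h s hs
        rw [Finset.mem_coe, Finset.mem_union] at hs
        rcases hs with hs | hs
        · exact hw.2.2.1 s hs
        · exact h s hs
    rw [hf]
    have := Finset.sum_powerset_neg_one_pow_card
      (x := (T \ Q).filter (fun s => cs.length w < cs.length (w * s)))
    have h2 := congrArg (fun z : ℤ => (z : ℚ)) this
    push_cast at h2
    rw [h2]
    simp only [Finset.filter_eq_empty_iff]
  · simp [hw]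

end Gam
end PQJ

namespace PQJ

open Classical

section Main

variable {B : Type*} [Fintype B] {W : Type*} [Group W] {M : CoxeterMatrix B}
  (cs : CoxeterSystem M W)

theorem one_mem_XX {K R Q : Finset W} (hR : (R : Set W) ⊆ Set.range cs.simple)
    (hQ : (Q : Set W) ⊆ Set.range cs.simple) :
    (1 : W) ∈ XX cs K R Q Q ↔ Q ⊆ R := by
  constructor
  · rintro ⟨_, _, _, h⟩ s hs
    rw [Finset.filter_eq_self] at h
    simpa using h s hs
  · intro h
    refine ⟨one_mem _, ?_, ?_, ?_⟩
    · intro s hs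
      obtain ⟨i, rfl⟩ := hR hs
      simp
    · intro s hs
      obtain ⟨i, rfl⟩ := hQ hs
      simp
    · rw [Finset.filter_eq_self]
      intro s hs
      simpa using h hs

theorem neg_pow_mem {U : Submodule Rat (PowerSeries ℚ)} {f : PowerSeries ℚ} (k : ℕ)
    (h : f ∈ U) : (-1 : PowerSeries ℚ) ^ k * f ∈ U := by
  rcases neg_one_pow_eq_or (PowerSeries ℚ) k with e | e
  · rw [e, one_mul]; exact h
  · rw [e, neg_one_mul]; exact neg_mem h

theorem main_rat (n : ℕ) : ∀ T : Finset W, T.card = n → (T : Set W) ⊆ Set.range cs.simple →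
    ∀ I K R : Finset W, (I : Set W) ⊆ Set.range cs.simple → K ⊆ T →
      gam cs (XX cs T I K R) ∈ Rat := by
  induction n using Nat.strong_induction_on with
  | _ n ih =>
  intro T hTn hT I K₀ R₀ hI hK₀
  by_cases hKT : K₀ = T
  · apply gam_bounded cs (m := 0)
    rintro w ⟨hw, _, hR, _⟩
    rw [hKT] at hR
    rw [eq_one_of_RM cs hT hw hR, cs.length_one]
  by_cases hRK : ¬ R₀ ⊆ K₀
  · apply gam_bounded cs (m := 0)
    rintro w ⟨_, _, _, h⟩
    exact absurd (h ▸ Finset.filter_subset _ _) hRK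
  push Not at hRK
  set G : Set (PowerSeries ℚ) :=
    ((fun p : Finset W × Finset W => gam cs (XX cs T I p.1 p.2)) ''
      ((T.powerset ×ˢ T.powerset).filter (fun p => p.1 ≠ T ∧ p.2 ⊆ p.1) : Finset _)) with hG
  have hGfin : G.Finite := (Finset.finite_toSet _).image _
  have hGmem : ∀ K R, K ⊆ T → K ≠ T → R ⊆ K → gam cs (XX cs T I K R) ∈ G := by
    intro K R h1 h2 h3
    refine ⟨(K, R), ?_, rfl⟩
    simp only [Finset.coe_filter, Finset.mem_product, Finset.mem_powerset, Set.mem_ofPred_eq]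
    exact ⟨⟨h1, h3.trans h1⟩, h2, h3⟩
  set V := Submodule.span Rat G with hV
  have h1 : ∀ K Q, Q ⊆ K → K ⊆ T → K ≠ T →
      gam cs (XX cs T I Q Q) - ∑ R ∈ K.powerset.filter (Q ⊆ ·), gam cs (XX cs T I K R)
        ∈ mm • V := by
    intro K Q hQK hKT hne
    have hKS : (K : Set W) ⊆ Set.range cs.simple := (Finset.coe_subset.2 hKT).trans hT
    rw [eqA cs hT hI hQK hKT, Finset.sum_filter, ← Finset.sum_sub_distrib]
    refine Submodule.sum_mem _ fun R hR => ?_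
    rw [Finset.mem_powerset] at hR
    have hRS : (R : Set W) ⊆ Set.range cs.simple := (Finset.coe_subset.2 hR).trans hKS
    have hQS : (Q : Set W) ⊆ Set.range cs.simple := (Finset.coe_subset.2 hQK).trans hKS
    have ha : gam cs (XX cs K R Q Q) ∈ Rat := by
      refine ih K.card ?_ K rfl hKS R Q Q hRS hQK
      rw [← hTn]
      exact Finset.card_lt_card (hKT.ssubset_of_ne hne)
    have hb : gam cs (XX cs K R Q Q) - (if Q ⊆ R then 1 else 0) ∈ Rat := by
      refine sub_mem ha ?_
      split_ifs
      · exact one_mem _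
      · exact zero_mem _
    have hm : (⟨_, hb⟩ : Rat) ∈ mm := by
      change PowerSeries.constantCoeff
        (gam cs (XX cs K R Q Q) - (if Q ⊆ R then 1 else 0) : PowerSeries ℚ) = 0
      rw [map_sub, gam_const, if_congr (one_mem_XX cs hRS hQS) rfl rfl]
      split_ifs <;> simp
    have := Submodule.smul_mem_smul hm (Submodule.subset_span (hGmem K R hKT hne hR) :
      gam cs (XX cs T I K R) ∈ V)
    convert this using 1
    change _ = (gam cs (XX cs K R Q Q) - (if Q ⊆ R then 1 else 0)) * gam cs (XX cs T I K R)
    split_ifs <;> ring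
  set U := Submodule.span Rat {(1 : PowerSeries ℚ)} ⊔ mm • V with hU
  have hRU : ∀ f ∈ Rat, f ∈ U := fun f hf => Submodule.mem_sup_left (mem_span_one.2 hf)
  have hmU : ∀ f ∈ mm • V, f ∈ U := fun f hf => Submodule.mem_sup_right hf
  have h2 : ∀ Q, Q ⊆ T → Q ≠ T → gam cs (XX cs T I Q Q) ∈ U := by
    intro Q hQT hne
    have hE := eqIE cs (T := T) (I := I) (Q := Q)
    have hER : gam cs {w | w ∈ XX cs T I Q Q ∧ ∀ s ∈ T \ Q, ¬ cs.length w < cs.length (w * s)}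
        ∈ Rat := by
      by_cases hemp : ∃ w₀, w₀ ∈ XX cs T I Q Q ∧ ∀ s ∈ T \ Q, ¬ cs.length w₀ < cs.length (w₀ * s)
      · obtain ⟨w₀, ⟨hT₀, hL₀, hR₀, hf₀⟩, hD₀⟩ := hemp
        apply gam_bounded cs (m := cs.length w₀)
        rintro y ⟨⟨hyT, _, hyR, _⟩, _⟩
        rw [Finset.filter_eq_self] at hf₀
        refine extremal_bound cs hT hI (Finset.coe_subset.2 hQT) hL₀ hf₀ ?_ hyT hyR
        intro s hs hsQ
        have := hD₀ s (Finset.mem_sdiff.2 ⟨hs, hsQ⟩)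
        exact lt_of_le_of_ne (not_lt.1 this) ((refl_of cs hT hs).length_mul_left_ne w₀)
      · apply gam_bounded cs (m := 0)
        intro w hw
        exact absurd ⟨w, hw⟩ hemp
    rw [← hE] at hER
    have hne' : (T \ Q).Nonempty := by
      rw [Finset.sdiff_nonempty]
      intro h
      exact hne (Finset.Subset.antisymm hQT h)
    have hz : ∑ L ∈ (T \ Q).powerset, (-1 : PowerSeries ℚ) ^ L.card = 0 := by
      have := congrArg (fun z : ℤ => (z : PowerSeries ℚ))
        (Finset.sum_powerset_neg_one_pow_card_of_nonempty hne')
      push_cast at this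
      exact this
    have hsum : ∑ L ∈ (T \ Q).powerset, (-1 : PowerSeries ℚ) ^ L.card *
        (gam cs {w | w ∈ XX cs T I Q Q ∧ RM cs ((Q ∪ L : Finset W) : Set W) w} -
          gam cs (XX cs T I Q Q)) ∈ U := by
      simp only [mul_sub]
      rw [Finset.sum_sub_distrib, ← Finset.sum_mul, hz, zero_mul, sub_zero]
      exact hRU _ hER
    rw [← Finset.sum_erase_add _ _ (Finset.mem_powerset_self (T \ Q))] at hsum
    have hrest : ∑ L ∈ (T \ Q).powerset.erase (T \ Q), (-1 : PowerSeries ℚ) ^ L.card *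
        (gam cs {w | w ∈ XX cs T I Q Q ∧ RM cs ((Q ∪ L : Finset W) : Set W) w} -
          gam cs (XX cs T I Q Q)) ∈ U := by
      refine Submodule.sum_mem _ fun L hL => neg_pow_mem _ (hmU _ ?_)
      rw [Finset.mem_erase, Finset.mem_powerset] at hL
      have hsub : Q ∪ L ⊆ T := Finset.union_subset hQT (hL.2.trans Finset.sdiff_subset)
      have hneq : Q ∪ L ≠ T := by
        intro h
        apply hL.1
        refine Finset.Subset.antisymm hL.2 ?_
        rw [← h]
        intro s hs
        rw [Finset.mem_sdiff, Finset.mem_union] at hs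
        exact hs.1.resolve_left hs.2
      rw [eqG cs Finset.subset_union_left, ← neg_sub]
      exact neg_mem (h1 _ _ Finset.subset_union_left hsub hneq)
    have hlast := (Submodule.add_mem_iff_right _ hrest).1 hsum
    have hlast' := neg_pow_mem (T \ Q).card hlast
    rw [← mul_assoc, ← mul_pow, neg_one_mul, neg_neg, one_pow, one_mul] at hlast'
    have hg : gam cs {w | w ∈ XX cs T I Q Q ∧ RM cs ((Q ∪ (T \ Q) : Finset W) : Set W) w}
        ∈ Rat := by
      apply gam_bounded cs (m := 0)
      rintro w ⟨⟨hw, _⟩, hR⟩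
      rw [Finset.union_sdiff_of_subset hQT] at hR
      rw [eq_one_of_RM cs hT hw hR, cs.length_one]
    have := sub_mem (hRU _ hg) hlast'
    rwa [sub_sub_cancel] at this
  have h3 : ∀ K Q, Q ⊆ K → K ⊆ T → K ≠ T →
      ∑ R ∈ K.powerset.filter (Q ⊆ ·), gam cs (XX cs T I K R) ∈ U := by
    intro K Q hQK hKT hne
    have hQne : Q ≠ T := by
      rintro rfl
      exact hne (Finset.Subset.antisymm hKT hQK)
    have := sub_mem (h2 Q (hQK.trans hKT) hQne) (hmU _ (h1 K Q hQK hKT hne))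
    rwa [sub_sub_cancel] at this
  have h4 : ∀ k K R, (K \ R).card = k → R ⊆ K → K ⊆ T → K ≠ T → gam cs (XX cs T I K R) ∈ U := by
    intro k
    induction k using Nat.strong_induction_on with
    | _ k ihk =>
    intro K R hk hRK hKT hne
    have := h3 K R hRK hKT hne
    have hmem : R ∈ K.powerset.filter (R ⊆ ·) := by simp [hRK]
    rw [← Finset.sum_erase_add _ _ hmem] at this
    refine (Submodule.add_mem_iff_right _ ?_).1 this
    refine Submodule.sum_mem _ fun R' hR' => ?_
    rw [Finset.mem_erase, Finset.mem_filter, Finset.mem_powerset] at hR'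
    refine ihk _ ?_ K R' rfl hR'.2.1 hKT hne
    rw [← hk]
    apply Finset.card_lt_card
    have hss : R ⊂ R' := hR'.2.2.ssubset_of_ne hR'.1.symm
    obtain ⟨x, hx, hxR⟩ := Finset.exists_of_ssubset hss
    refine Finset.ssubset_iff_subset_ne.2
      ⟨Finset.sdiff_subset_sdiff (Finset.Subset.refl _) hss.1, fun h => ?_⟩
    have hx2 : x ∈ K \ R' := by
      rw [h]
      exact Finset.mem_sdiff.2 ⟨hR'.2.1 hx, hxR⟩
    exact (Finset.mem_sdiff.1 hx2).2 hx
  refine nakayama hGfin ?_ _ (hGmem K₀ R₀ hK₀ hKT hRK)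
  rintro g ⟨⟨K, R⟩, hKR, rfl⟩
  simp only [Finset.coe_filter, Finset.mem_product, Finset.mem_powerset, Set.mem_ofPred_eq] at hKR
  exact h4 _ K R rfl hKR.2.2 hKR.1.1 hKR.2.1

end Main
end PQJ

theorem poincare_series_pQJ_rational
    {B : Type*} [Fintype B] {W : Type*} [Group W] {M : CoxeterMatrix B}
    (cs : CoxeterSystem M W) (J Q : Set B) (hQJ : Q ⊆ J) :
    ∃ P D : Polynomial ℚ, D.coeff 0 ≠ 0 ∧
      (D : PowerSeries ℚ) *
        PowerSeries.mk (fun n =>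
          (({x : W |
              (∀ a ∈ Subgroup.closure (cs.simple '' J),
               ∀ b ∈ Subgroup.closure (cs.simple '' J),
                cs.length x ≤ cs.length (a * x * b)) ∧
              {s : B | s ∈ J ∧ x * cs.simple s * x⁻¹ ∈ cs.simple '' J}
                = Q ∧
              cs.length x = n}).ncard : ℚ))
      = (P : PowerSeries ℚ) := by
  classical
  have hJS : cs.simple '' J ⊆ Set.range cs.simple := Set.image_subset_range _ _
  by_cases hsat : ∀ s ∈ J, cs.simple s ∈ cs.simple '' Q → s ∈ Q
  · have hfin : ∀ A : Set W, A ⊆ Set.range cs.simple → A.Finite :=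
      fun A hA => (Set.finite_range _).subset hA
    set T : Finset W := (Set.finite_range cs.simple).toFinset with hT
    set JJ : Finset W := (hfin _ hJS).toFinset with hJJ
    set QQ : Finset W := (hfin (cs.simple '' Q) (Set.image_subset_range _ _)).toFinset with hQQ
    have hTc : (T : Set W) = Set.range cs.simple := by simp [hT]
    have hJc : (JJ : Set W) = cs.simple '' J := by simp [hJJ]
    have hQc : (QQ : Set W) = cs.simple '' Q := by simp [hQQ]
    have hmain := PQJ.main_rat cs T.card T rfl hTc.le JJ JJ QQ (by rw [hJc]; exact hJS)
      (by rw [← Finset.coe_subset, hJc, hTc]; exact hJS)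
    have key : PQJ.XX cs T JJ JJ QQ = {x : W |
              (∀ a ∈ Subgroup.closure (cs.simple '' J),
               ∀ b ∈ Subgroup.closure (cs.simple '' J),
                cs.length x ≤ cs.length (a * x * b)) ∧
              {s : B | s ∈ J ∧ x * cs.simple s * x⁻¹ ∈ cs.simple '' J} = Q} := by
      ext x
      have hcl : x ∈ Subgroup.closure (T : Set W) := by
        rw [hTc, cs.subgroup_closure_range_simple]; trivial
      have hmJ : ∀ y, y ∈ JJ ↔ y ∈ cs.simple '' J := fun y => by rw [← hJc, Finset.mem_coe]
      have hmQ : ∀ y, y ∈ QQ ↔ y ∈ cs.simple '' Q := fun y => by rw [← hQc, Finset.mem_coe]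
      have hiff : JJ.filter (fun s => x * s * x⁻¹ ∈ JJ) = QQ ↔
          {s : B | s ∈ J ∧ x * cs.simple s * x⁻¹ ∈ cs.simple '' J} = Q := by
        constructor
        · intro h
          ext s
          have hs := Finset.ext_iff.1 h (cs.simple s)
          rw [Finset.mem_filter, hmJ, hmJ, hmQ] at hs
          constructor
          · rintro ⟨h1, h2⟩
            exact hsat s h1 (hs.1 ⟨⟨s, h1, rfl⟩, h2⟩)
          · intro hq
            exact ⟨hQJ hq, (hs.2 ⟨s, hq, rfl⟩).2⟩
        · intro h
          ext y
          rw [Finset.mem_filter, hmJ, hmJ, hmQ]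
          constructor
          · rintro ⟨⟨s, hs, rfl⟩, h2⟩
            have : s ∈ Q := by rw [← h]; exact ⟨hs, h2⟩
            exact ⟨s, this, rfl⟩
          · rintro ⟨s, hs, rfl⟩
            have hs' := hs
            rw [← h] at hs'
            exact ⟨⟨s, hs'.1, rfl⟩, hs'.2⟩
      change (_ ∧ _ ∧ _ ∧ _) ↔ (_ ∧ _)
      rw [PQJ.double_min cs hJS, ← hiff, hJc]
      tauto
    rw [PQJ.gam_eq_ncard, key] at hmain
    obtain ⟨P, D, hD, h⟩ := hmain
    refine ⟨P, D, hD, ?_⟩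
    rw [← h]
    congr 2
    funext n
    congr 2
    ext x
    exact ⟨fun ⟨a, b, c⟩ => ⟨⟨a, b⟩, c⟩, fun ⟨⟨a, b⟩, c⟩ => ⟨a, b, c⟩⟩
  · refine ⟨0, 1, by simp, ?_⟩
    push Not at hsat
    obtain ⟨s, hsJ, ⟨q, hq, hqs⟩, hsQ⟩ := hsat
    rw [Polynomial.coe_one, one_mul, Polynomial.coe_zero]
    ext n
    rw [PowerSeries.coeff_mk, map_zero, Nat.cast_eq_zero]
    convert Set.ncard_empty W
    rw [Set.eq_empty_iff_forall_notMem]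
    rintro x ⟨_, h, _⟩
    have hq' := hq
    rw [← h] at hq'
    apply hsQ
    rw [← h]
    refine ⟨hsJ, ?_⟩
    rw [← hqs]
    exact hq'.2
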